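/- Suppose T and U are skew tableaux of the same shape with at most l columns and entries from the alphabet [k]. Then U is dual equivalent to T if and only if U^C is dual equivalent to T^C, where both complements are formed with the same parameters k and l. -/

import Mathlib

/-- A partition: weakly decreasing, eventually zero. -/
def IsPartition (f : ℕ → ℕ) : Prop :=
  (∀ i, f (i + 1) ≤ f i) ∧ ∃ N, ∀ i, N ≤ i → f i = 0

/-- `b/a` is a horizontal strip. -/
def HStrip (a b : ℕ → ℕ) : Prop :=
  (∀ i, a i ≤ b i) ∧ (∀ i, b (i + 1) ≤ a i)

/-- A tableau with entries from `[k]`, as a chain of partitions. -/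
def IsTableau (k : ℕ) (T : ℕ → ℕ → ℕ) : Prop :=
  (∀ i, i ≤ k → IsPartition (T i)) ∧ ∀ i, i < k → HStrip (T i) (T (i + 1))

/-- The complement of a tableau with parameters `k` and `l`. -/
def comp (k l : ℕ) (T : ℕ → ℕ → ℕ) : ℕ → ℕ → ℕ :=
  fun i j => if j < i then l else T (k - i) (j - i)

/-- `b` covers `a`: `b/a` is a single box. -/
def CoverP (a b : ℕ → ℕ) : Prop :=
  ∃ r, b r = a r + 1 ∧ ∀ s, s ≠ r → b s = a s

/-- Fomin's local rule for a jeu de taquin slide across a pair of horizontal strips: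
given the chain `a ⊆ b ⊆ d`, it produces the fourth corner `g` with `a ⊆ g ⊆ d`,
`g_i = max{d_{i+1}, a_i} + min{d_i, a_{i-1}} − b_i` (in the top row there is no
constraint from above, so `g_0 = max{d_1, a_0} + d_0 − b_0`). -/
def jRule (a b d : ℕ → ℕ) : ℕ → ℕ
  | 0 => max (d 1) (a 0) + d 0 - b 0
  | i + 1 => max (d (i + 2)) (a (i + 1)) + min (d (i + 1)) (a i) - b (i + 1)

/-- The inward jeu de taquin slide of the chain `T`, started at the inner corner
given by the new inner border `a`. -/
def slideIn (T : ℕ → ℕ → ℕ) (a : ℕ → ℕ) : ℕ → ℕ → ℕ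
  | 0 => a
  | i + 1 => jRule (slideIn T a i) (T i) (T (i + 1))

def slideOutAux (k : ℕ) (T : ℕ → ℕ → ℕ) (d : ℕ → ℕ) : ℕ → ℕ → ℕ
  | 0 => d
  | m + 1 => jRule (T (k - (m + 1))) (T (k - m)) (slideOutAux k T d m)

/-- The outward (reverse) jeu de taquin slide of the chain `T` (of length `k`),
started at the outer corner given by the new outer border `d`. -/
def slideOut (k : ℕ) (T : ℕ → ℕ → ℕ) (d : ℕ → ℕ) : ℕ → ℕ → ℕ :=
  fun i => slideOutAux k T d (k - i)

/-- Apply the slide with the given instruction (`true`: inward slide starting at the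
given new inner border; `false`: outward slide towards the given new outer border). -/
def applyInstr (k : ℕ) (ins : Bool × (ℕ → ℕ)) (T : ℕ → ℕ → ℕ) : ℕ → ℕ → ℕ :=
  if ins.1 then slideIn T ins.2 else slideOut k T ins.2

/-- Apply a sequence of slide instructions. -/
def applyInstrs (k : ℕ) : List (Bool × (ℕ → ℕ)) → (ℕ → ℕ → ℕ) → (ℕ → ℕ → ℕ)
  | [], T => T
  | ins :: L, T => applyInstrs k L (applyInstr k ins T)

/-- A sequence of slide instructions is valid for `T` when at each step the chosen
border is a partition differing from the current inner (resp. outer) border of the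
current tableau by a single box. -/
def ValidSeq (k : ℕ) : List (Bool × (ℕ → ℕ)) → (ℕ → ℕ → ℕ) → Prop
  | [], _ => True
  | ins :: L, T =>
      (IsPartition ins.2 ∧
        (if ins.1 then CoverP ins.2 (T 0) else CoverP (T k) ins.2)) ∧
      ValidSeq k L (applyInstr k ins T)

/-- Dual equivalence: `T` and `U` have the same shape and applying any common
sequence of jeu de taquin slides to both always produces tableaux of the same shape. -/
def DualEquiv (k : ℕ) (T U : ℕ → ℕ → ℕ) : Prop :=
  T 0 = U 0 ∧ T k = U k ∧
  ∀ L, ValidSeq k L T → ValidSeq k L U →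
    (applyInstrs k L T) 0 = (applyInstrs k L U) 0 ∧
    (applyInstrs k L T) k = (applyInstrs k L U) k


/-- Lower bound for row `j` of a partition between `a` and `c` in a chain of horizontal strips. -/
def rowLo (a c : ℕ → ℕ) (j : ℕ) : ℕ := max (a j) (c (j + 1))

/-- Upper bound for row `j` of a partition between `a` and `c` in a chain of horizontal strips. -/
def rowHi (a c : ℕ → ℕ) : ℕ → ℕ
  | 0 => c 0
  | j + 1 => min (c (j + 1)) (a j)

/-- `b/a` is a single box in row `r`. -/
def CoverAt (r : ℕ) (a b : ℕ → ℕ) : Prop := b r = a r + 1 ∧ ∀ s, s ≠ r → b s = a s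

theorem jRule_apply (a b d : ℕ → ℕ) (j : ℕ) :
    jRule a b d j = rowLo a d j + rowHi a d j - b j := by
  cases j <;> simp [jRule, rowLo, rowHi, max_comm]

theorem hstrip_iff (a b c : ℕ → ℕ) :
    HStrip a b ∧ HStrip b c ↔ ∀ j, rowLo a c j ≤ b j ∧ b j ≤ rowHi a c j := by
  constructor
  · rintro ⟨⟨h1, h2⟩, h3, h4⟩ j
    cases j with
    | zero => have := h1 0; have := h3 0; have := h4 0; simp only [rowLo, rowHi]; omega
    | succ j =>
      have := h1 (j+1); have := h3 (j+1); have := h4 (j+1); have := h2 j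
      simp only [rowLo, rowHi]; omega
  · intro h
    refine ⟨⟨fun j => ?_, fun j => ?_⟩, fun j => ?_, fun j => ?_⟩
    · have := h j; simp only [rowLo] at this; omega
    · have := h (j+1); simp only [rowHi] at this; omega
    · have := h j; cases j <;> simp only [rowHi] at this <;> omega
    · have := h j; simp only [rowLo] at this; omega

theorem coverAt_square_iff {a b g d : ℕ → ℕ} {r s : ℕ} (hag : HStrip a g) (hbd : HStrip b d)
    (hab : CoverAt r a b) (hgd : CoverAt s g d) :
    (∀ j, g j + b j = rowLo a d j + rowHi a d j) ↔
      (s = r ∧ d (r + 1) ≠ b r) ∨ (s = r + 1 ∧ d (r + 1) = b r) := by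
  obtain ⟨h1, h2⟩ := hag
  obtain ⟨h3, h4⟩ := hbd
  obtain ⟨h5, h6⟩ := hab
  obtain ⟨h7, h8⟩ := hgd
  constructor
  · intro h
    by_cases hd : d (r + 1) = b r
    · right
      refine ⟨?_, hd⟩
      have := h (r + 1)
      simp only [rowLo, rowHi] at this
      by_contra hs
      grind
    · left
      refine ⟨?_, hd⟩
      have := h r
      cases r <;> simp only [rowLo, rowHi] at this <;> grind
  · rintro (⟨rfl, hd⟩ | ⟨rfl, hd⟩) j
    · cases j <;> simp only [rowLo, rowHi] <;> grind
    · cases j <;> simp only [rowLo, rowHi] <;> grind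

theorem exists_coverAt_jRule_inner {a b d : ℕ → ℕ} {r : ℕ} (ha : ∀ i, a (i + 1) ≤ a i)
    (hab : CoverAt r a b) (hbd : HStrip b d) :
    ∃ s, CoverAt s (jRule a b d) d ∧ HStrip a (jRule a b d) ∧
      ∀ j, jRule a b d j + b j = rowLo a d j + rowHi a d j := by
  obtain ⟨h3, h4⟩ := hbd
  obtain ⟨h5, h6⟩ := hab
  by_cases hd : d (r + 1) = b r
  · have key : jRule a b d = fun j => if j = r + 1 then d j - 1 else d j := by
      funext j
      rw [jRule_apply]
      cases j <;> simp only [rowLo, rowHi] <;> grind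
    refine ⟨r + 1, ?_⟩
    rw [key]
    have hag : HStrip a fun j => if j = r + 1 then d j - 1 else d j := by
      constructor <;> intro i <;> grind
    have hgd : CoverAt (r + 1) (fun j => if j = r + 1 then d j - 1 else d j) d := by
      constructor <;> grind
    exact ⟨hgd, hag, (coverAt_square_iff hag ⟨h3, h4⟩ ⟨h5, h6⟩ hgd).2 (Or.inr ⟨rfl, hd⟩)⟩
  · have key : jRule a b d = fun j => if j = r then d j - 1 else d j := by
      funext j
      rw [jRule_apply]
      cases j <;> simp only [rowLo, rowHi] <;> grind
    refine ⟨r, ?_⟩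
    rw [key]
    have hag : HStrip a fun j => if j = r then d j - 1 else d j := by
      constructor <;> intro i <;> grind
    have hgd : CoverAt r (fun j => if j = r then d j - 1 else d j) d := by
      constructor <;> grind
    exact ⟨hgd, hag, (coverAt_square_iff hag ⟨h3, h4⟩ ⟨h5, h6⟩ hgd).2 (Or.inl ⟨rfl, hd⟩)⟩

theorem exists_coverAt_jRule_outer {a g d : ℕ → ℕ} {s : ℕ} (hd : ∀ i, d (i + 1) ≤ d i)
    (hgd : CoverAt s g d) (hag : HStrip a g) :
    ∃ r, CoverAt r a (jRule a g d) ∧ HStrip (jRule a g d) d ∧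
      ∀ j, g j + jRule a g d j = rowLo a d j + rowHi a d j := by
  obtain ⟨h3, h4⟩ := hag
  obtain ⟨h5, h6⟩ := hgd
  by_cases hs : ∃ p, s = p + 1 ∧ g s = a p
  · obtain ⟨p, rfl, hp⟩ := hs
    have key : jRule a g d = fun j => if j = p then a j + 1 else a j := by
      funext j
      rw [jRule_apply]
      cases j <;> simp only [rowLo, rowHi] <;> grind
    refine ⟨p, ?_⟩
    rw [key]
    have hbd : HStrip (fun j => if j = p then a j + 1 else a j) d := by
      constructor <;> intro i <;> grind
    have hab : CoverAt p a (fun j => if j = p then a j + 1 else a j) := by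
      constructor <;> grind
    refine ⟨hab, hbd, (coverAt_square_iff ⟨h3, h4⟩ hbd hab ⟨h5, h6⟩).2 (Or.inr ⟨rfl, ?_⟩)⟩
    grind
  · have key : jRule a g d = fun j => if j = s then a j + 1 else a j := by
      funext j
      rw [jRule_apply]
      cases j <;> simp only [rowLo, rowHi] <;> grind
    refine ⟨s, ?_⟩
    rw [key]
    have hbd : HStrip (fun j => if j = s then a j + 1 else a j) d := by
      constructor
      · intro i; cases i <;> grind
      · intro i; grind
    have hab : CoverAt s a (fun j => if j = s then a j + 1 else a j) := by
      constructor <;> grind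
    refine ⟨hab, hbd, (coverAt_square_iff ⟨h3, h4⟩ hbd hab ⟨h5, h6⟩).2 (Or.inl ⟨rfl, ?_⟩)⟩
    grind

/-- Bracketing rows from the top: number of unmatched opening brackets before row `j`, when
row `j` contributes `Y j` closing brackets followed by `X j` opening ones. -/
def openCount (X Y : ℕ → ℕ) : ℕ → ℕ
  | 0 => 0
  | j + 1 => openCount X Y j - Y j + X j

/-- Number of free boxes of the first kind in row `j` of the two-letter tableau `a ⊆ b ⊆ c`. -/
def freeFst (a b c : ℕ → ℕ) (j : ℕ) : ℕ := b j - rowLo a c j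

/-- Number of free boxes of the second kind in row `j` of the two-letter tableau `a ⊆ b ⊆ c`. -/
def freeSnd (a b c : ℕ → ℕ) (j : ℕ) : ℕ := rowHi a c j - b j

/-- Number of unmatched second letters in row `j` of the two-letter tableau `a ⊆ b ⊆ c`. -/
def unmatched (a b c : ℕ → ℕ) (j : ℕ) : ℕ :=
  freeSnd a b c j - openCount (freeFst a b c) (freeSnd a b c) j

/-- The highest-weight element in the `sl₂`-string of the two-letter tableau `a ⊆ b ⊆ c`. -/
def highest (a b c : ℕ → ℕ) (j : ℕ) : ℕ := b j + unmatched a b c j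

theorem le_highest (a b c : ℕ → ℕ) (j : ℕ) : b j ≤ highest a b c j := Nat.le_add_right _ _

theorem hstrip_highest {a b c : ℕ → ℕ} (hab : HStrip a b) (hbc : HStrip b c) :
    HStrip a (highest a b c) ∧ HStrip (highest a b c) c := by
  have h := (hstrip_iff a b c).1 ⟨hab, hbc⟩
  refine (hstrip_iff _ _ _).2 fun j => ?_
  have := h j
  simp only [highest, unmatched, freeSnd]
  omega

theorem openCount_transfer {X Y X' Y' : ℕ → ℕ} {r δ ε : ℕ} (hr : r = 0 → δ = 0)
    (hX : ∀ j, X' j + (if j = r then ε else 0) = X j + (if j + 1 = r then δ else 0))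
    (hY : ∀ j, Y' j + (if j = r + 1 then ε else 0) = Y j + (if j = r then δ else 0)) (j : ℕ) :
    openCount X' Y' j + (if j = r + 1 then ε else 0) =
      openCount X Y j + (if j = r then δ else 0) := by
  induction j with
  | zero =>
    rw [if_neg (by omega : ¬ 0 = r + 1)]
    split_ifs with h
    · simp [openCount, hr h.symm]
    · rfl
  | succ j ih =>
    have h1 := hX j
    have h2 := hY j
    simp only [openCount]
    clear hX hY
    split_ifs at * <;> omega

theorem openCount_shift {X Y X' Y' : ℕ → ℕ} {r : ℕ} (hY : Y' = Y) (hr : Y (r + 1) = 0)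
    (hX : ∀ j, X' j + (if j = r + 1 then 1 else 0) = X j + (if j = r then 1 else 0)) (j : ℕ) :
    openCount X' Y' j = openCount X Y j + (if j = r + 1 then 1 else 0) := by
  subst hY
  induction j with
  | zero => simp [openCount]
  | succ j ih =>
    have h1 := hX j
    simp only [openCount]
    by_cases hj : j = r + 1
    · subst hj
      split_ifs at * <;> omega
    · split_ifs at * <;> omega

theorem openCount_swap {X Y X' Y' : ℕ → ℕ} {r : ℕ} (hX : X' = X) (hr : X r = 0)
    (hY : ∀ j, Y' j + (if j = r + 1 then 1 else 0) = Y j + (if j = r then 1 else 0)) (j : ℕ) :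
    openCount X Y j =
      openCount X' Y' j + (if j = r + 1 ∧ Y r < openCount X Y r then 1 else 0) := by
  subst hX
  induction j with
  | zero => simp [openCount]
  | succ j ih =>
    have h1 := hY j
    clear hY
    simp only [openCount]
    by_cases hj : j = r
    · subst hj
      split_ifs at * <;> omega
    · by_cases hj' : j = r + 1
      · subst hj'
        have h2 : openCount X' Y (r + 1) = openCount X' Y r - Y r + X' r := rfl
        split_ifs at * <;> omega
      · split_ifs at * <;> omega

/-- Slides across a two-letter tableau commute with passing to the highest-weight element. -/
theorem highest_square {a' a b' b c' c : ℕ → ℕ} {r s t : ℕ}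
    (hab' : HStrip a' b') (hbc' : HStrip b' c') (hab : HStrip a b) (hbc : HStrip b c)
    (ha : CoverAt r a' a) (hb : CoverAt s b' b) (hc : CoverAt t c' c)
    (h₁ : ∀ j, b' j + a j = rowLo a' b j + rowHi a' b j)
    (h₂ : ∀ j, c' j + b j = rowLo b' c j + rowHi b' c j) :
    ∃ s', CoverAt s' (highest a' b' c') (highest a b c) ∧
      (∀ j, highest a' b' c' j + a j =
        rowLo a' (highest a b c) j + rowHi a' (highest a b c) j) ∧
      (∀ j, c' j + highest a b c j =
        rowLo (highest a' b' c') c j + rowHi (highest a' b' c') c j) := by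
  obtain ⟨hH1', hH2'⟩ := hstrip_highest hab' hbc'
  obtain ⟨hH1, hH2⟩ := hstrip_highest hab hbc
  have k₁ := (coverAt_square_iff hab' hab ha hb).1 h₁
  have k₂ := (coverAt_square_iff hbc' hbc hb hc).1 h₂
  suffices h : ∃ s', CoverAt s' (highest a' b' c') (highest a b c) ∧
      ((s' = r ∧ highest a b c (r + 1) ≠ a r) ∨ (s' = r + 1 ∧ highest a b c (r + 1) = a r)) ∧
      ((t = s' ∧ c (s' + 1) ≠ highest a b c s') ∨
        (t = s' + 1 ∧ c (s' + 1) = highest a b c s')) by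
    obtain ⟨s', hs, h3, h4⟩ := h
    exact ⟨s', hs, (coverAt_square_iff hH1' hH1 ha hs).2 h3,
      (coverAt_square_iff hH2' hH2 hs hc).2 h4⟩
  have hl := (hstrip_iff a b c).1 ⟨hab, hbc⟩
  have hl' := (hstrip_iff a' b' c').1 ⟨hab', hbc'⟩
  have keep : (∀ j, unmatched a' b' c' j = unmatched a b c j) →
      CoverAt s (highest a' b' c') (highest a b c) := by
    intro h
    refine ⟨?_, fun j hj => ?_⟩
    · have := hb.1; have := h s; simp only [highest]; omega
    · have := hb.2 j hj; have := h j; simp only [highest]; omega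
  rcases k₁ with ⟨rfl, k₁⟩ | ⟨rfl, k₁⟩ <;> rcases k₂ with ⟨rfl, k₂⟩ | ⟨rfl, k₂⟩
  · have hX : ∀ j, freeFst a' b' c' j + (if j = t then (if a t ≤ c (t + 1) then 1 else 0) else 0) =
        freeFst a b c j +
          (if j + 1 = t then (if rowHi a c t < c t then 1 else 0) else 0) := by
      intro j
      have := hl j
      have := hl' j
      have := hab.1 t
      clear hl hl' h₁ h₂ keep hH1 hH2 hH1' hH2' hab hab' hbc hbc'
      obtain ⟨q1, q2⟩ := ha
      obtain ⟨q3, q4⟩ := hb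
      obtain ⟨q5, q6⟩ := hc
      have : rowHi a c (j + 1) = min (c (j + 1)) (a j) := rfl
      simp only [freeFst, rowLo] at *
      grind
    have hY : ∀ j, freeSnd a' b' c' j +
          (if j = t + 1 then (if a t ≤ c (t + 1) then 1 else 0) else 0) =
        freeSnd a b c j + (if j = t then (if rowHi a c t < c t then 1 else 0) else 0) := by
      intro j
      have := hl j
      have := hl' j
      have := hab.1 t
      clear hl hl' h₁ h₂ keep hH1 hH2 hH1' hH2' hab hab' hbc hbc'
      obtain ⟨q1, q2⟩ := ha
      obtain ⟨q3, q4⟩ := hb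
      obtain ⟨q5, q6⟩ := hc
      cases j <;> simp only [freeSnd, rowHi] at * <;> grind
    have hq := openCount_transfer (fun h => by subst h; simp [rowHi]) hX hY
    have hu : ∀ j, unmatched a' b' c' j = unmatched a b c j := by
      intro j
      have := hq j
      have := hY j
      simp only [unmatched]
      omega
    refine ⟨t, keep hu, Or.inl ⟨rfl, ?_⟩, Or.inl ⟨rfl, ?_⟩⟩
    · have := (keep hu).2 (t + 1) (by omega)
      have := hH1'.2 t
      have := ha.1
      omega
    · have := le_highest a b c t
      have := hbc.2 t
      omega
  · have hX : freeFst a' b' c' = freeFst a b c := by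
      funext j
      have := hl j
      have := hl' j
      have := hab.1 s
      clear hl hl' h₁ h₂ keep hH1 hH2 hH1' hH2' hab hab' hbc hbc'
      obtain ⟨q1, q2⟩ := ha
      obtain ⟨q3, q4⟩ := hb
      obtain ⟨q5, q6⟩ := hc
      simp only [freeFst, rowLo] at *
      grind
    have hr : freeFst a b c s = 0 := by
      simp only [freeFst, rowLo]
      omega
    have hY : ∀ j, freeSnd a' b' c' j + (if j = s + 1 then 1 else 0) =
        freeSnd a b c j + (if j = s then 1 else 0) := by
      intro j
      have := hl j
      have := hl' j
      have := hab.1 s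
      clear hl hl' h₁ h₂ keep hH1 hH2 hH1' hH2' hab hab' hbc hbc'
      obtain ⟨q1, q2⟩ := ha
      obtain ⟨q3, q4⟩ := hb
      obtain ⟨q5, q6⟩ := hc
      cases j <;> simp only [freeSnd, rowHi] at * <;> grind
    have hq := openCount_swap hX hr hY
    by_cases hlt : freeSnd a b c s < openCount (freeFst a b c) (freeSnd a b c) s
    · have hu : ∀ j, unmatched a' b' c' j = unmatched a b c j := by
        intro j
        have := hq j
        have := hY j
        simp only [unmatched]
        grind
      refine ⟨s, keep hu, Or.inl ⟨rfl, ?_⟩, Or.inr ⟨rfl, ?_⟩⟩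
      · have := (keep hu).2 (s + 1) (by omega)
        have := hH1'.2 s
        have := ha.1
        omega
      · simp only [highest, unmatched]
        omega
    · have hq1 : openCount (freeFst a b c) (freeSnd a b c) (s + 1) = 0 := by
        simp only [openCount]; omega
      have hu : ∀ j, unmatched a' b' c' j + (if j = s + 1 then 1 else 0) =
          unmatched a b c j + (if j = s then 1 else 0) := by
        intro j
        have := hq j
        have := hY j
        simp only [unmatched]
        grind
      have hcov : CoverAt (s + 1) (highest a' b' c') (highest a b c) := by
        refine ⟨?_, fun j hj => ?_⟩
        · have := hb.2 (s + 1) (by omega); have := hu (s + 1); simp only [highest]; grind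
        · have := hb.1; have := hb.2 j; have := hu j; simp only [highest]; grind
      have htop : highest a b c (s + 1) = a s := by
        have := hl (s + 1)
        have := hab.1 s
        simp only [highest, unmatched, hq1, freeSnd, rowHi] at *
        omega
      refine ⟨s + 1, hcov, Or.inr ⟨rfl, htop⟩, Or.inl ⟨rfl, ?_⟩⟩
      have := hc.2 (s + 1 + 1) (by omega)
      have := hH2'.2 (s + 1)
      have := hcov.1
      omega
  · have hY : freeSnd a' b' c' = freeSnd a b c := by
      funext j
      have := hl j
      have := hl' j
      have := hab.1 (r + 1)
      have := hab'.1 (r + 1)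
      clear hl hl' h₁ h₂ keep hH1 hH2 hH1' hH2' hab hab' hbc hbc'
      obtain ⟨q1, q2⟩ := ha
      obtain ⟨q3, q4⟩ := hb
      obtain ⟨q5, q6⟩ := hc
      cases j <;> simp only [freeSnd, rowHi] at * <;> grind
    have hr : freeSnd a b c (r + 1) = 0 := by
      simp only [freeSnd, rowHi]
      omega
    have hX : ∀ j, freeFst a' b' c' j + (if j = r + 1 then 1 else 0) =
        freeFst a b c j + (if j = r then 1 else 0) := by
      intro j
      have := hl j
      have := hl' j
      have := hbc.1 (r + 1)
      have := hab.1 (r + 1)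
      have := hab'.1 (r + 1)
      clear hl hl' h₁ h₂ keep hH1 hH2 hH1' hH2' hab hab' hbc hbc'
      obtain ⟨q1, q2⟩ := ha
      obtain ⟨q3, q4⟩ := hb
      obtain ⟨q5, q6⟩ := hc
      simp only [freeFst, rowLo] at *
      grind
    have hq := openCount_shift hY hr hX
    have hu : ∀ j, unmatched a' b' c' j = unmatched a b c j := by
      intro j
      have := hq j
      simp only [unmatched, hY] at *
      by_cases hj : j = r + 1
      · subst hj; omega
      · grind
    refine ⟨r + 1, keep hu, Or.inr ⟨rfl, ?_⟩, Or.inl ⟨rfl, ?_⟩⟩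
    · simp only [highest, unmatched]
      omega
    · have := le_highest a b c (r + 1)
      have := hbc.2 (r + 1)
      omega
  · have hY : freeSnd a' b' c' = freeSnd a b c := by
      funext j
      have := hl j
      have := hl' j
      have := hab.1 (r + 1)
      have := hab'.1 (r + 1)
      clear hl hl' h₁ h₂ keep hH1 hH2 hH1' hH2' hab hab' hbc hbc'
      obtain ⟨q1, q2⟩ := ha
      obtain ⟨q3, q4⟩ := hb
      obtain ⟨q5, q6⟩ := hc
      cases j <;> simp only [freeSnd, rowHi] at * <;> grind
    have hr : freeSnd a b c (r + 1) = 0 := by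
      simp only [freeSnd, rowHi]
      omega
    have hX : freeFst a' b' c' = freeFst a b c := by
      funext j
      have := hl j
      have := hl' j
      have := hbc.1 (r + 1)
      have := hab.1 (r + 1)
      have := hab'.1 (r + 1)
      clear hl hl' h₁ h₂ keep hH1 hH2 hH1' hH2' hab hab' hbc hbc'
      obtain ⟨q1, q2⟩ := ha
      obtain ⟨q3, q4⟩ := hb
      obtain ⟨q5, q6⟩ := hc
      simp only [freeFst, rowLo] at *
      grind
    have hu : ∀ j, unmatched a' b' c' j = unmatched a b c j := by
      intro j
      simp only [unmatched, hX, hY]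
    have hz : unmatched a b c (r + 1) = 0 := by
      simp only [unmatched]
      omega
    refine ⟨r + 1, keep hu, Or.inr ⟨rfl, ?_⟩, Or.inr ⟨rfl, ?_⟩⟩
    · simp only [highest]
      omega
    · simp only [highest]
      omega

theorem HStrip.isPartition_left {a b : ℕ → ℕ} (h : HStrip a b) (hb : IsPartition b) :
    IsPartition a := by
  obtain ⟨N, hN⟩ := hb.2
  refine ⟨fun i => (h.1 (i + 1)).trans (h.2 i), N, fun i hi => ?_⟩
  have := h.1 i
  have := hN i hi
  omega

theorem IsTableau.congr {k : ℕ} {T U : ℕ → ℕ → ℕ} (hT : IsTableau k T)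
    (h : ∀ j, j ≤ k → U j = T j) : IsTableau k U := by
  refine ⟨fun i hi => h i hi ▸ hT.1 i hi, fun i hi => ?_⟩
  rw [h i hi.le, h (i + 1) hi]
  exact hT.2 i hi

theorem IsTableau.apply_le {k : ℕ} {T : ℕ → ℕ → ℕ} (hT : IsTableau k T) {i m : ℕ} (him : i ≤ m)
    (hm : m ≤ k) (j : ℕ) : T i j ≤ T m j := by
  induction m, him using Nat.le_induction with
  | base => exact le_rfl
  | succ m him ih => exact (ih (by omega)).trans ((hT.2 m hm).1 j)

/-- Replace level `n + 1` of a tableau by the highest-weight element in the `sl₂`-string of the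
two adjacent letters `n + 1` and `n + 2`. -/
def raise (n : ℕ) (T : ℕ → ℕ → ℕ) : ℕ → ℕ → ℕ :=
  Function.update T (n + 1) (highest (T n) (T (n + 1)) (T (n + 2)))

theorem raise_self (n : ℕ) (T : ℕ → ℕ → ℕ) :
    raise n T (n + 1) = highest (T n) (T (n + 1)) (T (n + 2)) := by
  simp [raise]

theorem raise_of_ne {n i : ℕ} (h : i ≠ n + 1) (T : ℕ → ℕ → ℕ) : raise n T i = T i := by
  simp [raise, h]

theorem raise_congr {k n : ℕ} (hn : n + 1 < k) {T U : ℕ → ℕ → ℕ}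
    (h : ∀ j, j ≤ k → U j = T j) {j : ℕ} (hj : j ≤ k) : raise n U j = raise n T j := by
  by_cases hjn : j = n + 1
  · subst hjn
    rw [raise_self, raise_self, h n (by omega), h (n + 1) hj, h (n + 2) hn]
  · rw [raise_of_ne hjn, raise_of_ne hjn, h j hj]

theorem IsTableau.raise {k n : ℕ} {T : ℕ → ℕ → ℕ} (hT : IsTableau k T) (hn : n + 1 < k) :
    IsTableau k (raise n T) := by
  obtain ⟨h1, h2⟩ := hstrip_highest (hT.2 n (by omega)) (hT.2 (n + 1) hn)
  refine ⟨fun i hi => ?_, fun i hi => ?_⟩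
  · by_cases hin : i = n + 1
    · subst hin
      rw [raise_self]
      exact h2.isPartition_left (hT.1 (n + 2) hn)
    · rw [raise_of_ne hin]
      exact hT.1 i hi
  · by_cases hin : i = n + 1
    · subst hin
      rw [raise_self, raise_of_ne (by omega)]
      exact h2
    · by_cases hin' : i = n
      · subst hin'
        rw [raise_self, raise_of_ne (by omega)]
        exact h1
      · rw [raise_of_ne hin, raise_of_ne (by omega)]
        exact hT.2 i hi

/-- `T'` arises from `T` by an inward slide (equivalently, `T` from `T'` by an outward one). -/
def IsSlide (k : ℕ) (T' T : ℕ → ℕ → ℕ) : Prop :=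
  IsTableau k T' ∧ IsTableau k T ∧ (∀ i, i ≤ k → CoverP (T' i) (T i)) ∧
    ∀ i, i < k → ∀ j, T' (i + 1) j + T i j = rowLo (T' i) (T (i + 1)) j + rowHi (T' i) (T (i + 1)) j

theorem IsSlide.raise {k n : ℕ} {T' T : ℕ → ℕ → ℕ} (h : IsSlide k T' T) (hn : n + 1 < k) :
    IsSlide k (raise n T') (raise n T) := by
  obtain ⟨hT', hT, hc, hs⟩ := h
  obtain ⟨r, hr⟩ := hc n (by omega)
  obtain ⟨s, hs'⟩ := hc (n + 1) hn.le
  obtain ⟨t, ht⟩ := hc (n + 2) hn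
  obtain ⟨q, h1, h2, h3⟩ := highest_square (hT'.2 n (by omega)) (hT'.2 (n + 1) hn)
    (hT.2 n (by omega)) (hT.2 (n + 1) hn) hr hs' ht (hs n (by omega)) (hs (n + 1) hn)
  refine ⟨hT'.raise hn, hT.raise hn, fun i hi => ?_, fun i hi => ?_⟩
  · by_cases hin : i = n + 1
    · subst hin
      rw [raise_self, raise_self]
      exact ⟨q, h1⟩
    · rw [raise_of_ne hin, raise_of_ne hin]
      exact hc i hi
  · by_cases hin : i = n + 1
    · subst hin
      rw [raise_self, raise_self, raise_of_ne (by omega), raise_of_ne (by omega)]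
      exact h3
    · by_cases hin' : i = n
      · subst hin'
        rw [raise_self, raise_self, raise_of_ne (by omega), raise_of_ne (by omega)]
        exact h2
      · rw [raise_of_ne hin, raise_of_ne hin, raise_of_ne (by omega), raise_of_ne (by omega)]
        exact hs i hi

theorem IsSlide.congr_right {k : ℕ} {T' T U : ℕ → ℕ → ℕ} (h : IsSlide k T' T)
    (hU : ∀ j, j ≤ k → U j = T j) : IsSlide k T' U := by
  obtain ⟨hT', hT, hc, hs⟩ := h
  refine ⟨hT', hT.congr hU, fun i hi => ?_, fun i hi => ?_⟩
  · rw [hU i hi]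
    exact hc i hi
  · rw [hU i hi.le, hU (i + 1) hi]
    exact hs i hi

theorem IsSlide.congr_left {k : ℕ} {T' T U : ℕ → ℕ → ℕ} (h : IsSlide k T' T)
    (hU : ∀ j, j ≤ k → U j = T' j) : IsSlide k U T := by
  obtain ⟨hT', hT, hc, hs⟩ := h
  refine ⟨hT'.congr hU, hT, fun i hi => ?_, fun i hi => ?_⟩
  · rw [hU i hi]
    exact hc i hi
  · rw [hU i hi.le, hU (i + 1) hi]
    exact hs i hi

theorem IsSlide.slideIn_eq {k : ℕ} {T' T : ℕ → ℕ → ℕ} (h : IsSlide k T' T) {i : ℕ} (hi : i ≤ k) :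
    slideIn T (T' 0) i = T' i := by
  induction i with
  | zero => rfl
  | succ i ih =>
    funext j
    have := h.2.2.2 i hi j
    rw [slideIn, ih (by omega), jRule_apply]
    omega

theorem slideOut_last (k : ℕ) (T : ℕ → ℕ → ℕ) (d : ℕ → ℕ) : slideOut k T d k = d := by
  simp [slideOut, slideOutAux]

theorem slideOut_of_lt {k i : ℕ} (hi : i < k) (T : ℕ → ℕ → ℕ) (d : ℕ → ℕ) :
    slideOut k T d i = jRule (T i) (T (i + 1)) (slideOut k T d (i + 1)) := by
  obtain ⟨m, rfl⟩ : ∃ m, k = i + 1 + m := ⟨k - (i + 1), by omega⟩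
  simp only [slideOut]
  rw [show i + 1 + m - i = m + 1 by omega, show i + 1 + m - (i + 1) = m by omega, slideOutAux,
    show i + 1 + m - (m + 1) = i by omega, show i + 1 + m - m = i + 1 by omega]

theorem IsSlide.slideOut_eq {k : ℕ} {T' T : ℕ → ℕ → ℕ} (h : IsSlide k T' T) {i : ℕ} (hi : i ≤ k) :
    slideOut k T' (T k) i = T i := by
  induction hi using Nat.decreasingInduction with
  | self => exact slideOut_last _ _ _
  | of_succ i hi ih =>
    funext j
    have := h.2.2.2 i hi j
    rw [slideOut_of_lt hi, ih, jRule_apply]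
    omega

theorem isSlide_slideIn {k : ℕ} {T : ℕ → ℕ → ℕ} {a : ℕ → ℕ} (hT : IsTableau k T)
    (ha : IsPartition a) (hc : CoverP a (T 0)) : IsSlide k (slideIn T a) T := by
  have step : ∀ i, i < k → IsPartition (slideIn T a i) → CoverP (slideIn T a i) (T i) →
      CoverP (slideIn T a (i + 1)) (T (i + 1)) ∧ HStrip (slideIn T a i) (slideIn T a (i + 1)) ∧
      IsPartition (slideIn T a (i + 1)) ∧ ∀ j, slideIn T a (i + 1) j + T i j =
        rowLo (slideIn T a i) (T (i + 1)) j + rowHi (slideIn T a i) (T (i + 1)) j := by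
    rintro i hi hp ⟨r, hr⟩
    obtain ⟨s, h1, h2, h3⟩ := exists_coverAt_jRule_inner hp.1 hr (hT.2 i hi)
    refine ⟨⟨s, h1⟩, h2, ⟨fun j => (h2.2 j).trans (h2.1 j), ?_⟩, h3⟩
    obtain ⟨N, hN⟩ := (hT.1 (i + 1) hi).2
    refine ⟨N, fun j hj => ?_⟩
    have := hN j hj
    have h4 := h1.1
    have h5 := h1.2 j
    rw [slideIn]
    by_cases hjs : j = s
    · subst hjs; omega
    · have := h5 hjs; omega
  have main : ∀ i, i ≤ k → IsPartition (slideIn T a i) ∧ CoverP (slideIn T a i) (T i) := by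
    intro i
    induction i with
    | zero => exact fun _ => ⟨ha, hc⟩
    | succ i ih =>
      intro hi
      obtain ⟨h1, h2⟩ := ih (by omega)
      obtain ⟨h3, -, h4, -⟩ := step i hi h1 h2
      exact ⟨h4, h3⟩
  exact ⟨⟨fun i hi => (main i hi).1, fun i hi => (step i hi (main i hi.le).1 (main i hi.le).2).2.1⟩,
    hT, fun i hi => (main i hi).2, fun i hi => (step i hi (main i hi.le).1 (main i hi.le).2).2.2.2⟩

theorem isSlide_slideOut {k : ℕ} {T : ℕ → ℕ → ℕ} {d : ℕ → ℕ} (hT : IsTableau k T)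
    (hd : IsPartition d) (hc : CoverP (T k) d) : IsSlide k T (slideOut k T d) := by
  have step : ∀ i, i < k → IsPartition (slideOut k T d (i + 1)) →
      CoverP (T (i + 1)) (slideOut k T d (i + 1)) →
      CoverP (T i) (slideOut k T d i) ∧ HStrip (slideOut k T d i) (slideOut k T d (i + 1)) ∧
      IsPartition (slideOut k T d i) ∧ ∀ j, T (i + 1) j + slideOut k T d i j =
        rowLo (T i) (slideOut k T d (i + 1)) j + rowHi (T i) (slideOut k T d (i + 1)) j := by
    rintro i hi hp ⟨s, hs⟩
    obtain ⟨r, h1, h2, h3⟩ := exists_coverAt_jRule_outer hp.1 hs (hT.2 i hi)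
    rw [← slideOut_of_lt hi] at h1 h2 h3
    exact ⟨⟨r, h1⟩, h2, h2.isPartition_left hp, h3⟩
  have main : ∀ i, i ≤ k → IsPartition (slideOut k T d i) ∧ CoverP (T i) (slideOut k T d i) := by
    intro i hi
    induction hi using Nat.decreasingInduction with
    | self => rw [slideOut_last]; exact ⟨hd, hc⟩
    | of_succ i hi ih =>
      obtain ⟨h3, -, h4, -⟩ := step i hi ih.1 ih.2
      exact ⟨h4, h3⟩
  exact ⟨hT, ⟨fun i hi => (main i hi).1, fun i hi => (step i hi (main _ hi).1 (main _ hi).2).2.1⟩,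
    fun i hi => (main i hi).2, fun i hi => (step i hi (main _ hi).1 (main _ hi).2).2.2.2⟩

/-- The slide instruction `ins` can be applied to `T`. -/
def ValidInstr (k : ℕ) (ins : Bool × (ℕ → ℕ)) (T : ℕ → ℕ → ℕ) : Prop :=
  IsPartition ins.2 ∧ if ins.1 then CoverP ins.2 (T 0) else CoverP (T k) ins.2

/-- `U` agrees, up to level `k`, with `T` or with some `raise n T`. -/
def RaiseStep (k : ℕ) (T U : ℕ → ℕ → ℕ) : Prop :=
  IsTableau k T ∧ IsTableau k U ∧
    ∃ V, (V = T ∨ ∃ n, n + 1 < k ∧ V = raise n T) ∧ ∀ j, j ≤ k → U j = V j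

/-- `T` and `U` lie in the same connected component of the crystal. -/
def Linked (k : ℕ) : (ℕ → ℕ → ℕ) → (ℕ → ℕ → ℕ) → Prop := Relation.EqvGen (RaiseStep k)

theorem linked_of_eq {k : ℕ} {T U : ℕ → ℕ → ℕ} (hT : IsTableau k T)
    (h : ∀ j, j ≤ k → U j = T j) : Linked k T U :=
  .rel _ _ ⟨hT, hT.congr h, T, Or.inl rfl, h⟩

theorem linked_raise {k n : ℕ} {T : ℕ → ℕ → ℕ} (hT : IsTableau k T) (hn : n + 1 < k) :
    Linked k T (raise n T) :=
  .rel _ _ ⟨hT, hT.raise hn, _, Or.inr ⟨n, hn, rfl⟩, fun _ _ => rfl⟩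

theorem RaiseStep.border {k : ℕ} {T U : ℕ → ℕ → ℕ} (h : RaiseStep k T U) :
    T 0 = U 0 ∧ T k = U k := by
  obtain ⟨-, -, V, rfl | ⟨n, hn, rfl⟩, hV⟩ := h
  · exact ⟨(hV 0 (by omega)).symm, (hV k le_rfl).symm⟩
  · rw [hV 0 (by omega), hV k le_rfl, raise_of_ne (by omega), raise_of_ne (by omega)]
    exact ⟨rfl, rfl⟩

theorem Linked.border {k : ℕ} {T U : ℕ → ℕ → ℕ} (h : Linked k T U) : T 0 = U 0 ∧ T k = U k := by
  induction h with
  | rel _ _ h => exact h.border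
  | refl _ => exact ⟨rfl, rfl⟩
  | symm _ _ _ ih => exact ⟨ih.1.symm, ih.2.symm⟩
  | trans _ _ _ _ _ ih1 ih2 => exact ⟨ih1.1.trans ih2.1, ih1.2.trans ih2.2⟩

theorem Linked.map {k : ℕ} {P : (ℕ → ℕ) → (ℕ → ℕ) → Prop}
    {F : (ℕ → ℕ → ℕ) → ℕ → ℕ → ℕ}
    (hF : ∀ T U, RaiseStep k T U → P (T 0) (T k) → RaiseStep k (F T) (F U))
    {T U : ℕ → ℕ → ℕ} (h : Linked k T U) (hP : P (T 0) (T k)) : Linked k (F T) (F U) := by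
  induction h with
  | rel _ _ h => exact .rel _ _ (hF _ _ h hP)
  | refl _ => exact .refl _
  | symm _ _ h ih =>
    obtain ⟨h1, h2⟩ := Linked.border h
    exact .symm _ _ (ih (by rwa [h1, h2]))
  | trans _ _ _ h _ ih1 ih2 =>
    obtain ⟨h1, h2⟩ := Linked.border h
    exact .trans _ _ _ (ih1 hP) (ih2 (by rwa [← h1, ← h2]))

theorem RaiseStep.applyInstr {k : ℕ} {ins : Bool × (ℕ → ℕ)} {T U : ℕ → ℕ → ℕ}
    (h : RaiseStep k T U) (hv : ValidInstr k ins T) :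
    RaiseStep k (applyInstr k ins T) (applyInstr k ins U) := by
  obtain ⟨b, a⟩ := ins
  obtain ⟨hT, -, V, hV, hUV⟩ := h
  obtain ⟨hp, hc⟩ := hv
  cases b
  · change CoverP (T k) a at hc
    change RaiseStep k (slideOut k T a) (slideOut k U a)
    have hsl := isSlide_slideOut hT hp hc
    rcases hV with rfl | ⟨n, hn, rfl⟩
    · have h2 := hsl.congr_left hUV
      refine ⟨hsl.2.1, (isSlide_slideOut h2.1 hp ?_).2.1, _, Or.inl rfl, fun j hj => ?_⟩
      · rwa [hUV k le_rfl]
      · have := h2.slideOut_eq hj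
        rwa [slideOut_last] at this
    · have h2 := (hsl.raise hn).congr_left hUV
      refine ⟨hsl.2.1, (isSlide_slideOut h2.1 hp ?_).2.1, _, Or.inr ⟨n, hn, rfl⟩, fun j hj => ?_⟩
      · rwa [hUV k le_rfl, raise_of_ne (by omega)]
      · have := h2.slideOut_eq hj
        rwa [raise_of_ne (by omega), slideOut_last] at this
  · change CoverP a (T 0) at hc
    change RaiseStep k (slideIn T a) (slideIn U a)
    have hsl := isSlide_slideIn hT hp hc
    rcases hV with rfl | ⟨n, hn, rfl⟩
    · have h2 := hsl.congr_right hUV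
      refine ⟨hsl.1, (isSlide_slideIn h2.2.1 hp ?_).1, _, Or.inl rfl, fun j hj => h2.slideIn_eq hj⟩
      rwa [hUV 0 (by omega)]
    · have h2 := (hsl.raise hn).congr_right hUV
      refine ⟨hsl.1, (isSlide_slideIn h2.2.1 hp ?_).1, _, Or.inr ⟨n, hn, rfl⟩, fun j hj => ?_⟩
      · rwa [hUV 0 (by omega), raise_of_ne (by omega)]
      · have := h2.slideIn_eq hj
        rwa [raise_of_ne (by omega)] at this

theorem Linked.applyInstr {k : ℕ} {ins : Bool × (ℕ → ℕ)} {T U : ℕ → ℕ → ℕ}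
    (h : Linked k T U) (hv : ValidInstr k ins T) :
    Linked k (applyInstr k ins T) (applyInstr k ins U) :=
  h.map (P := fun a b => IsPartition ins.2 ∧ if ins.1 then CoverP ins.2 a else CoverP b ins.2)
    (fun _ _ h hv => h.applyInstr hv) hv

theorem Linked.dualEquiv {k : ℕ} {T U : ℕ → ℕ → ℕ} (h : Linked k T U) : DualEquiv k T U := by
  refine ⟨h.border.1, h.border.2, fun L hL hL' => ?_⟩
  suffices h : Linked k (applyInstrs k L T) (applyInstrs k L U) from h.border
  induction L generalizing T U with
  | nil => exact h
  | cons ins L ih =>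
    obtain ⟨hv, hL⟩ := hL
    exact ih (h.applyInstr hv) hL hL'.2

theorem DualEquiv.applyInstr {k : ℕ} {ins : Bool × (ℕ → ℕ)} {T U : ℕ → ℕ → ℕ}
    (h : DualEquiv k T U) (hv : ValidInstr k ins T) :
    DualEquiv k (applyInstr k ins T) (applyInstr k ins U) := by
  obtain ⟨h0, hk, h⟩ := h
  have hv' : ValidInstr k ins U := by
    unfold ValidInstr
    rw [← h0, ← hk]
    exact hv
  obtain ⟨h1, h2⟩ := h [ins] ⟨hv, trivial⟩ ⟨hv', trivial⟩
  exact ⟨h1, h2, fun L hL hL' => h (ins :: L) ⟨hv, hL⟩ ⟨hv', hL'⟩⟩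

/-- The highest-weight tableau of straight shape `c`. -/
def yamanouchi (c : ℕ → ℕ) : ℕ → ℕ → ℕ := fun i j => if j < i then c j else 0

theorem IsTableau.apply_eq_zero {k : ℕ} {T : ℕ → ℕ → ℕ} (hT : IsTableau k T)
    (h0 : ∀ j, T 0 j = 0) {i j : ℕ} (hi : i ≤ k) (hij : i ≤ j) : T i j = 0 := by
  induction i generalizing j with
  | zero => exact h0 j
  | succ i ih =>
    obtain ⟨j, rfl⟩ : ∃ m, j = m + 1 := ⟨j - 1, by omega⟩
    have := (hT.2 i hi).2 j
    have := ih (j := j) (by omega) (by omega)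
    omega

theorem eq_yamanouchi {k : ℕ} {T : ℕ → ℕ → ℕ} (hT : IsTableau k T) (h0 : ∀ j, T 0 j = 0)
    (h : ∀ n, n + 1 < k → ∀ j, unmatched (T n) (T (n + 1)) (T (n + 2)) j = 0) {i : ℕ}
    (hi : i ≤ k) : T i = yamanouchi (T k) i := by
  have step : ∀ i, i + 1 ≤ k → ∀ j, j < i → T i j = T (i + 1) j := by
    intro i
    induction i with
    | zero => omega
    | succ i ih =>
      intro hi j hj
      have ih := ih (by omega)
      have hx : ∀ j, j < i → freeFst (T i) (T (i + 1)) (T (i + 2)) j = 0 := by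
        intro j hj
        have := ih j hj
        simp only [freeFst, rowLo]
        omega
      have hq : ∀ m, m ≤ i →
          openCount (freeFst (T i) (T (i + 1)) (T (i + 2))) (freeSnd (T i) (T (i + 1)) (T (i + 2))) m
            = 0 := by
        intro m
        induction m with
        | zero => exact fun _ => rfl
        | succ m ihm =>
          intro hm
          simp only [openCount, ihm (by omega), hx m (by omega)]
          omega
      have hu := h i hi j
      have h1 : T (i + 1) j ≤ T (i + 2) j := (hT.2 (i + 1) hi).1 j
      rw [unmatched, hq j (by omega), freeSnd] at hu
      cases j with
      | zero =>
        change T (i + 1) 0 = T (i + 2) 0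
        simp only [rowHi] at hu
        omega
      | succ j =>
        have := ih j (by omega)
        have := (hT.2 (i + 1) hi).2 j
        simp only [rowHi] at hu
        simp only [show i + 1 + 1 = i + 2 from rfl] at *
        omega
  funext j
  unfold yamanouchi
  split_ifs with hj
  · suffices ∀ m, i ≤ m → m ≤ k → T i j = T m j from this k hi le_rfl
    intro m him
    induction m, him using Nat.le_induction with
    | base => exact fun _ => rfl
    | succ m him ih => exact fun hm => (ih (by omega)).trans (step m hm j (by omega))
  · exact hT.apply_eq_zero h0 hi (by omega)

theorem linked_yamanouchi {k : ℕ} {T : ℕ → ℕ → ℕ} (hT : IsTableau k T) (h0 : ∀ j, T 0 j = 0) :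
    Linked k T (yamanouchi (T k)) := by
  induction hm : ∑ i ∈ Finset.range (k + 1), ∑ j ∈ Finset.range k, (T k j - T i j)
    using Nat.strong_induction_on generalizing T with
  | _ m ih =>
    by_cases h : ∀ n, n + 1 < k → ∀ j, unmatched (T n) (T (n + 1)) (T (n + 2)) j = 0
    · exact linked_of_eq hT fun j hj => (eq_yamanouchi hT h0 h hj).symm
    · push Not at h
      obtain ⟨n, hn, j, hj⟩ := h
      have hR := hT.raise hn
      have hk : raise n T k = T k := raise_of_ne (by omega) T
      have hR0 : ∀ j, raise n T 0 j = 0 := fun j => by rw [raise_of_ne (by omega), h0]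
      have hle : ∀ i j, T i j ≤ raise n T i j := by
        intro i j
        by_cases hi : i = n + 1
        · subst hi
          rw [raise_self]
          exact le_highest _ _ _ _
        · rw [raise_of_ne hi]
      have hlt : T (n + 1) j < raise n T (n + 1) j := by
        rw [raise_self, highest]
        omega
      have hjn : j < n + 1 := by
        by_contra hc
        have := hR.apply_eq_zero hR0 hn.le (by omega : n + 1 ≤ j)
        omega
      have hl : Linked k (raise n T) (yamanouchi (T k)) := by
        rw [← hk]
        refine ih _ ?_ hR hR0 rfl
        rw [← hm, hk]
        refine Finset.sum_lt_sum (fun i _ => Finset.sum_le_sum fun j _ => ?_)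
          ⟨n + 1, by simp; omega, Finset.sum_lt_sum (fun j _ => ?_) ⟨j, by simp; omega, ?_⟩⟩
        · have := hle i j; omega
        · have := hle (n + 1) j; omega
        · have := hR.apply_le hn.le le_rfl j
          rw [hk] at this
          omega
      exact .trans _ _ _ (linked_raise hT hn) hl

theorem exists_coverP_of_ne_zero {b : ℕ → ℕ} (hb : IsPartition b) (h : ∃ j, b j ≠ 0) :
    ∃ a, IsPartition a ∧ CoverP a b := by
  classical
  obtain ⟨N, hN⟩ := hb.2
  have hex : ∃ n, ∀ j, n ≤ j → b j = 0 := ⟨N, hN⟩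
  have hs := Nat.find_spec hex
  have hpos : Nat.find hex ≠ 0 := by
    intro h0
    obtain ⟨j, hj⟩ := h
    exact hj (hs j (by omega))
  obtain ⟨r, hr⟩ := Nat.exists_eq_succ_of_ne_zero hpos
  have hbr : b r ≠ 0 := by
    intro h0
    refine Nat.find_min hex (m := r) (by omega) fun j hj => ?_
    by_cases hjr : j = r
    · rw [hjr, h0]
    · exact hs j (by omega)
  have hcov : CoverAt r (fun j => if j = r then b j - 1 else b j) b := by
    constructor
    · simp only [if_true]; omega
    · intro s hs; simp [hs]
  refine ⟨fun j => if j = r then b j - 1 else b j, ⟨fun i => ?_, N, fun i hi => ?_⟩, r, hcov⟩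
  · have := hb.1 i
    have := hs (r + 1) (by omega)
    grind
  · have := hN i hi
    grind

theorem DualEquiv.linked {k : ℕ} {T U : ℕ → ℕ → ℕ} (hT : IsTableau k T) (hU : IsTableau k U)
    (h : DualEquiv k T U) : Linked k T U := by
  obtain ⟨N, hN⟩ := (hT.1 0 (by omega)).2
  induction hm : ∑ j ∈ Finset.range N, T 0 j using Nat.strong_induction_on generalizing T U with
  | _ m ih =>
    by_cases hz : ∀ j, T 0 j = 0
    · refine .trans _ _ _ (linked_yamanouchi hT hz) (.symm _ _ ?_)
      rw [h.2.1]
      exact linked_yamanouchi hU (by rwa [← h.1])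
    · push Not at hz
      obtain ⟨a, ha, r, hr⟩ := exists_coverP_of_ne_zero (hT.1 0 (by omega)) hz
      have hsT := isSlide_slideIn hT ha ⟨r, hr⟩
      have hsU := isSlide_slideIn hU ha (by rw [← h.1]; exact ⟨r, hr⟩)
      have hd : DualEquiv k (slideIn T a) (slideIn U a) :=
        h.applyInstr (ins := (true, a)) ⟨ha, r, hr⟩
      have hle : ∀ j, a j ≤ T 0 j := by
        intro j
        by_cases hj : j = r
        · have := hr.1; subst hj; omega
        · exact (hr.2 j hj).ge
      have hrN : r < N := by
        by_contra hc
        have := hN r (by omega)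
        have := hr.1
        omega
      have hl : Linked k (slideIn T a) (slideIn U a) := by
        refine ih _ ?_ hsT.1 hsU.1 hd (fun j hj => ?_) rfl
        · rw [← hm]
          refine Finset.sum_lt_sum (fun j _ => hle j) ⟨r, by simpa using hrN, ?_⟩
          have := hr.1
          simp only [slideIn]
          omega
        · have := hle j
          have := hN j hj
          simp only [slideIn]
          omega
      have hl' : Linked k (slideOut k (slideIn T a) (T k)) (slideOut k (slideIn U a) (T k)) :=
        hl.applyInstr (ins := (false, T k)) ⟨hT.1 k le_rfl, hsT.2.2.1 k le_rfl⟩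
      refine .trans _ _ _ (linked_of_eq hT fun j hj => hsT.slideOut_eq hj)
        (.trans _ _ _ hl' (.symm _ _ (linked_of_eq hU fun j hj => ?_)))
      rw [h.2.1]
      exact hsU.slideOut_eq hj

/-- Prepend `m` parts equal to `l`. -/
def prepend (l m : ℕ) (f : ℕ → ℕ) (j : ℕ) : ℕ := if j < m then l else f (j - m)

theorem prepend_of_lt {l m j : ℕ} (h : j < m) (f : ℕ → ℕ) : prepend l m f j = l := if_pos h

theorem prepend_add (l m j : ℕ) (f : ℕ → ℕ) : prepend l m f (j + m) = f j := by
  simp [prepend]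

theorem comp_eq_prepend (k l : ℕ) (T : ℕ → ℕ → ℕ) (i : ℕ) :
    comp k l T i = prepend l i (T (k - i)) := rfl

theorem highest_prepend {l m : ℕ} {a b c : ℕ → ℕ} (hc : c 0 ≤ l) :
    highest (prepend l m c) (prepend l (m + 1) b) (prepend l (m + 2) a) =
      prepend l (m + 1) (highest a b c) := by
  have hlow : ∀ j, j < m + 1 →
      freeFst (prepend l m c) (prepend l (m + 1) b) (prepend l (m + 2) a) j = 0 ∧
      freeSnd (prepend l m c) (prepend l (m + 1) b) (prepend l (m + 2) a) j = 0 := by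
    intro j hj
    constructor
    · simp only [freeFst, rowLo, prepend_of_lt hj, prepend_of_lt (show j + 1 < m + 2 by omega)]
      omega
    · have h2 := prepend_of_lt (l := l) (show j < m + 2 by omega) a
      cases j with
      | zero => simp only [freeSnd, rowHi, prepend_of_lt hj, h2]; omega
      | succ j => simp only [freeSnd, rowHi, prepend_of_lt hj, h2]; omega
  have hhigh : ∀ j,
      freeFst (prepend l m c) (prepend l (m + 1) b) (prepend l (m + 2) a) (j + (m + 1)) =
        freeFst a b c j ∧
      freeSnd (prepend l m c) (prepend l (m + 1) b) (prepend l (m + 2) a) (j + (m + 1)) =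
        freeSnd a b c j := by
    intro j
    have e1 : prepend l m c (j + (m + 1)) = c (j + 1) := by
      rw [← prepend_add l m (j + 1) c]; congr 1; omega
    have e2 : prepend l (m + 2) a (j + (m + 1) + 1) = a j := prepend_add l (m + 2) j a
    have e3 := prepend_add l (m + 1) j b
    constructor
    · simp only [freeFst, rowLo, e1, e2, e3, max_comm]
    · cases j with
      | zero =>
        have e4 : prepend l (m + 2) a (0 + m + 1) = l := prepend_of_lt (by omega) a
        have e5 := prepend_add l m 0 c
        simp only [freeSnd, e3]
        rw [show 0 + (m + 1) = (0 + m) + 1 by omega]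
        simp only [rowHi, e4, e5]
        omega
      | succ j =>
        have e4 : prepend l (m + 2) a (j + (m + 1) + 1) = a j := prepend_add l (m + 2) j a
        have e5 : prepend l m c (j + (m + 1)) = c (j + 1) := by
          rw [← prepend_add l m (j + 1) c]; congr 1; omega
        simp only [freeSnd, e3]
        rw [show j + 1 + (m + 1) = (j + (m + 1)) + 1 by omega]
        simp only [rowHi, e4, e5, min_comm]
  have hq0 : ∀ j, j ≤ m + 1 →
      openCount (freeFst (prepend l m c) (prepend l (m + 1) b) (prepend l (m + 2) a))
        (freeSnd (prepend l m c) (prepend l (m + 1) b) (prepend l (m + 2) a)) j = 0 := by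
    intro j
    induction j with
    | zero => exact fun _ => rfl
    | succ j ih =>
      intro hj
      simp only [openCount, ih (by omega), (hlow j hj).1]
      omega
  have hq : ∀ j,
      openCount (freeFst (prepend l m c) (prepend l (m + 1) b) (prepend l (m + 2) a))
        (freeSnd (prepend l m c) (prepend l (m + 1) b) (prepend l (m + 2) a)) (j + (m + 1)) =
      openCount (freeFst a b c) (freeSnd a b c) j := by
    intro j
    induction j with
    | zero => rw [hq0 _ (by omega)]; rfl
    | succ j ih =>
      rw [show j + 1 + (m + 1) = j + (m + 1) + 1 by omega, openCount, openCount, ih,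
        (hhigh j).1, (hhigh j).2]
  funext j
  by_cases hj : j < m + 1
  · simp only [highest, unmatched, prepend_of_lt hj, (hlow j hj).2]
    omega
  · obtain ⟨p, rfl⟩ : ∃ p, j = p + (m + 1) := ⟨j - (m + 1), by omega⟩
    rw [prepend_add]
    simp only [highest, unmatched, prepend_add, hq, (hhigh p).2]

theorem IsTableau.comp {k l : ℕ} {T : ℕ → ℕ → ℕ} (hT : IsTableau k T) (hl : ∀ r, T k r ≤ l) :
    IsTableau k (comp k l T) := by
  have hl' : ∀ i, i ≤ k → ∀ r, T i r ≤ l := fun i hi r => (hT.apply_le hi le_rfl r).trans (hl r)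
  refine ⟨fun i hi => ⟨fun j => ?_, ?_⟩, fun i hi => ⟨fun j => ?_, fun j => ?_⟩⟩
  · have h1 := hl' (k - i) (by omega)
    have h2 := (hT.1 (k - i) (by omega)).1 (j - i)
    have h3 := h1 (j + 1 - i)
    simp only [_root_.comp]
    split_ifs
    · exact le_rfl
    · omega
    · exact h3
    · rwa [show j + 1 - i = j - i + 1 by omega]
  · obtain ⟨N, hN⟩ := (hT.1 (k - i) (by omega)).2
    refine ⟨N + i, fun j hj => ?_⟩
    simp only [_root_.comp]
    rw [if_neg (by omega), hN _ (by omega)]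
  · simp only [_root_.comp]
    split_ifs
    · exact le_rfl
    · omega
    · exact hl' _ (by omega) _
    · have := (hT.2 (k - (i + 1)) (by omega)).2 (j - (i + 1))
      rwa [show k - (i + 1) + 1 = k - i by omega, show j - (i + 1) + 1 = j - i by omega] at this
  · simp only [_root_.comp]
    split_ifs
    · exact le_rfl
    · omega
    · exact hl' _ (by omega) _
    · have := (hT.2 (k - (i + 1)) (by omega)).1 (j - i)
      rw [show j + 1 - (i + 1) = j - i by omega]
      rwa [show k - (i + 1) + 1 = k - i by omega] at this

theorem comp_raise {k l n : ℕ} {T : ℕ → ℕ → ℕ} (hT : IsTableau k T) (hl : ∀ r, T k r ≤ l)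
    (hn : n + 1 < k) {i : ℕ} (hi : i ≤ k) :
    comp k l (raise n T) i = raise (k - (n + 2)) (comp k l T) i := by
  obtain ⟨m, rfl⟩ : ∃ m, k = m + (n + 2) := ⟨k - (n + 2), by omega⟩
  rw [Nat.add_sub_cancel]
  by_cases him : i = m + 1
  · subst him
    simp only [raise_self, comp_eq_prepend]
    rw [show m + (n + 2) - (m + 1) = n + 1 by omega, show m + (n + 2) - m = n + 2 by omega,
      show m + (n + 2) - (m + 2) = n by omega, raise_self, highest_prepend]
    exact (hT.apply_le (by omega) le_rfl 0).trans (hl 0)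
  · rw [raise_of_ne him, comp_eq_prepend, comp_eq_prepend, raise_of_ne (by omega)]

/-- Inverse of `comp`: drop the first `i` parts of the `i`-th partition and reverse the chain. -/
def uncomp (k : ℕ) (V : ℕ → ℕ → ℕ) : ℕ → ℕ → ℕ := fun i j => V (k - i) (j + (k - i))

theorem uncomp_comp {k l i : ℕ} (hi : i ≤ k) (T : ℕ → ℕ → ℕ) :
    uncomp k (comp k l T) i = T i := by
  funext j
  rw [uncomp, comp_eq_prepend, prepend_add, show k - (k - i) = i by omega]

theorem comp_uncomp {k l i : ℕ} {V : ℕ → ℕ → ℕ} (hV : IsTableau k V)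
    (h1 : ∀ j, j < k → V k j = l) (h2 : ∀ j, V k j ≤ l) (hi : i ≤ k) :
    comp k l (uncomp k V) i = V i := by
  have key : ∀ i, i ≤ k → ∀ j, j < i → V i j = l := by
    intro i hi
    induction hi using Nat.decreasingInduction with
    | self => exact h1
    | of_succ i hi ih =>
      intro j hj
      have := (hV.2 i hi).2 j
      have := ih (j + 1) (by omega)
      have := (hV.apply_le hi.le le_rfl j).trans (h2 j)
      omega
  funext j
  rw [comp_eq_prepend, prepend]
  split_ifs with hj
  · exact (key i hi j hj).symm
  · simp only [uncomp]
    rw [show k - (k - i) = i by omega, show j - i + i = j by omega]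

theorem IsTableau.uncomp {k : ℕ} {V : ℕ → ℕ → ℕ} (hV : IsTableau k V) :
    IsTableau k (uncomp k V) := by
  refine ⟨fun i hi => ⟨fun j => ?_, ?_⟩, fun i hi => ⟨fun j => ?_, fun j => ?_⟩⟩
  · have := (hV.1 (k - i) (by omega)).1 (j + (k - i))
    simp only [_root_.uncomp]
    rwa [show j + 1 + (k - i) = j + (k - i) + 1 by omega]
  · obtain ⟨N, hN⟩ := (hV.1 (k - i) (by omega)).2
    exact ⟨N, fun j hj => hN _ (by omega)⟩
  · have := (hV.2 (k - (i + 1)) (by omega)).2 (j + (k - (i + 1)))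
    simp only [_root_.uncomp]
    rwa [show k - (i + 1) + 1 = k - i by omega,
      show j + (k - (i + 1)) + 1 = j + (k - i) by omega] at this
  · have := (hV.2 (k - (i + 1)) (by omega)).1 (j + (k - i))
    simp only [_root_.uncomp]
    rw [show j + 1 + (k - (i + 1)) = j + (k - i) by omega]
    rwa [show k - (i + 1) + 1 = k - i by omega] at this

theorem comp_congr {k l : ℕ} {T U : ℕ → ℕ → ℕ} (h : ∀ j, j ≤ k → U j = T j) (i : ℕ) :
    comp k l U i = comp k l T i := by
  rw [comp_eq_prepend, comp_eq_prepend, h _ (by omega)]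

theorem uncomp_congr {k : ℕ} {T U : ℕ → ℕ → ℕ} (h : ∀ j, j ≤ k → U j = T j) (i : ℕ) :
    uncomp k U i = uncomp k T i := by
  funext j
  rw [uncomp, uncomp, h _ (by omega)]

theorem RaiseStep.comp {k l : ℕ} {T U : ℕ → ℕ → ℕ} (h : RaiseStep k T U)
    (hl : ∀ r, T k r ≤ l) : RaiseStep k (comp k l T) (comp k l U) := by
  have hUl : ∀ r, U k r ≤ l := h.border.2 ▸ hl
  obtain ⟨hT, hU, V, rfl | ⟨n, hn, rfl⟩, hV⟩ := h
  · exact ⟨hT.comp hl, hU.comp hUl, _, Or.inl rfl, fun j _ => comp_congr hV j⟩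
  · refine ⟨hT.comp hl, hU.comp hUl, _, Or.inr ⟨k - (n + 2), by omega, rfl⟩, fun j hj => ?_⟩
    rw [comp_congr hV, comp_raise hT hl hn hj]

theorem RaiseStep.uncomp {k l : ℕ} {V W : ℕ → ℕ → ℕ} (h : RaiseStep k V W)
    (h1 : ∀ j, j < k → V k j = l) (h2 : ∀ j, V k j ≤ l) :
    RaiseStep k (uncomp k V) (uncomp k W) := by
  obtain ⟨hV, hW, X, rfl | ⟨m, hm, rfl⟩, hX⟩ := h
  · exact ⟨hV.uncomp, hW.uncomp, _, Or.inl rfl, fun j _ => uncomp_congr hX j⟩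
  · refine ⟨hV.uncomp, hW.uncomp, _, Or.inr ⟨k - (m + 2), by omega, rfl⟩, fun j hj => ?_⟩
    have hl : ∀ r, _root_.uncomp k V k r ≤ l := fun r => by
      simp only [_root_.uncomp]
      exact (hV.apply_le (by omega) le_rfl _).trans (h2 _)
    rw [uncomp_congr hX, ← uncomp_comp (l := l) hj (raise _ _)]
    refine uncomp_congr (fun i hi => ?_) j
    rw [comp_raise hV.uncomp hl (by omega) hi, show k - (k - (m + 2) + 2) = m by omega]
    exact (raise_congr hm (fun j hj => comp_uncomp hV h1 h2 hj) hi).symm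

/-- **Complementation preserves dual equivalence.**  Suppose `T` and `U` are skew
tableaux of the same shape with at most `l` columns and entries from `[k]`.  Then `U`
is dual equivalent to `T` if and only if `U^C` is dual equivalent to `T^C`, both
complements formed with the same parameters `k` and `l`. -/
theorem complement_dual_equivalence (k l : ℕ) (T U : ℕ → ℕ → ℕ)
    (hT : IsTableau k T) (hU : IsTableau k U)
    (h0 : T 0 = U 0) (hk : T k = U k)
    (hTl : ∀ r, T k r ≤ l) :
    DualEquiv k T U ↔ DualEquiv k (comp k l T) (comp k l U) := by
  have hUl : ∀ r, U k r ≤ l := hk ▸ hTl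
  constructor
  · intro h
    exact ((h.linked hT hU).map (P := fun _ b => ∀ r, b r ≤ l)
      (fun _ _ h hl => h.comp hl) hTl).dualEquiv
  · intro h
    have hT' := hT.comp hTl
    have hU' := hU.comp hUl
    have h1 : ∀ j, j < k → comp k l T k j = l := fun j hj => prepend_of_lt hj _
    have h2 : ∀ j, comp k l T k j ≤ l := fun j => by
      rw [comp_eq_prepend, prepend]
      split_ifs
      · exact le_rfl
      · exact (hT.apply_le (by omega) le_rfl _).trans (hTl _)
    have hl := (h.linked hT' hU').map (P := fun _ b => (∀ j, j < k → b j = l) ∧ ∀ j, b j ≤ l)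
      (fun _ _ h hl => h.uncomp hl.1 hl.2) ⟨h1, h2⟩
    exact Linked.dualEquiv (.trans _ _ _ (linked_of_eq hT fun j hj => uncomp_comp hj T)
      (.trans _ _ _ hl (.symm _ _ (linked_of_eq hU fun j hj => uncomp_comp hj U))))
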